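/- 𝒞_2(8,4,3) = 1275; that is, the maximum cardinality of a cyclic code C ⊆ G_2(8,3) with minimum subspace distance at least 4 equals 1275, attained by a code consisting of 5 orbits of cardinality 255. -/

import Mathlib

open Module

/-- The cyclic shift `αV = {αv : v ∈ V}` of an `Fq`-subspace `V` of the extension field `F`
by a field element `α`. -/
def cyclicShift (Fq F : Type*) [Field Fq] [Field F] [Algebra Fq F]
    (α : F) (V : Submodule Fq F) : Submodule Fq F :=
  Submodule.map (LinearMap.mulLeft Fq α) V

/-- The subspace distance `d(U,W) = dim U + dim W − 2 dim (U ∩ W)`. -/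
noncomputable def subspaceDist (Fq F : Type*) [Field Fq] [Field F] [Algebra Fq F]
    (U W : Submodule Fq F) : ℕ :=
  finrank Fq U + finrank Fq W - 2 * finrank Fq ↥(U ⊓ W)

/-- `C` is a cyclic code in the Grassmannian `G_q(n,k)` (all members have dimension `k`,
and `C` is closed under cyclic shifts by nonzero field elements) with minimum subspace
distance at least `d`. -/
def IsCyclicCode (Fq F : Type*) [Field Fq] [Field F] [Algebra Fq F]
    (k d : ℕ) (C : Set (Submodule Fq F)) : Prop :=
  (∀ U ∈ C, finrank Fq U = k) ∧
  (∀ α : F, α ≠ 0 → ∀ U ∈ C, cyclicShift Fq F α U ∈ C) ∧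
  (∀ U ∈ C, ∀ W ∈ C, U ≠ W → d ≤ subspaceDist Fq F U W)

/-- The orbit `orb(V) = {αV : α ∈ F, α ≠ 0}` of a subspace `V`. -/
def orbitOf (Fq F : Type*) [Field Fq] [Field F] [Algebra Fq F]
    (V : Submodule Fq F) : Set (Submodule Fq F) :=
  {W | ∃ α : F, α ≠ 0 ∧ W = cyclicShift Fq F α V}

/-- The set of orbits of members of a code `C`. -/
def orbitsOf (Fq F : Type*) [Field Fq] [Field F] [Algebra Fq F]
    (C : Set (Submodule Fq F)) : Set (Set (Submodule Fq F)) :=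
  {O | ∃ V ∈ C, O = orbitOf Fq F V}

open Polynomial in
/-- The primitive polynomial `X ^ 8 + X ^ 4 + X ^ 3 + X ^ 2 + 1` over `𝔽₂`. -/
noncomputable def primitivePoly : (ZMod 2)[X] := X ^ 8 + X ^ 4 + X ^ 3 + X ^ 2 + 1

/-- The value at `α` of the polynomial over `𝔽₂` whose coefficients are the lowest nine binary
digits of `n`. -/
def bitEval {R : Type*} [CommRing R] (α : R) (n : ℕ) : R :=
  ∑ i ∈ Finset.range 9, if n.testBit i then α ^ i else 0

/-- Multiplication by `X` modulo `primitivePoly` on binary coefficient vectors;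
`285` encodes `primitivePoly`. -/
def mulX (n : ℕ) : ℕ := if n < 128 then 2 * n else (2 * n) ^^^ 285

/-- The coefficient vector of `X ^ k` modulo `primitivePoly`. -/
def powX (k : ℕ) : ℕ := mulX^[k] 1

@[simp]
lemma bitEval_one {R : Type*} [CommRing R] (α : R) : bitEval α 1 = 1 := by
  simp [bitEval, Finset.sum_range_succ, Nat.testBit]

lemma bitEval_two_mul {R : Type*} [CommRing R] (α : R) {n : ℕ} (hn : n < 256) :
    bitEval α (2 * n) = α * bitEval α n := by
  have h8 : n.testBit 8 = false := Nat.testBit_lt_two_pow hn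
  rw [bitEval, bitEval, Finset.sum_range_succ', Finset.sum_range_succ _ 8, h8]
  simp [Finset.mul_sum, Nat.testBit_succ, pow_succ']

section Arithmetic

variable {R : Type*} [CommRing R] [Algebra (ZMod 2) R] {α : R}

lemma bitEval_xor (m n : ℕ) : bitEval α (m ^^^ n) = bitEval α m + bitEval α n := by
  simp only [bitEval, ← Finset.sum_add_distrib, Nat.testBit_xor]
  refine Finset.sum_congr rfl fun i _ => ?_
  cases m.testBit i <;> cases n.testBit i <;> simp [ZModModule.add_self]

lemma bitEval_mulX (hα : α ^ 8 + α ^ 4 + α ^ 3 + α ^ 2 + 1 = 0) {n : ℕ} (hn : n < 256) :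
    bitEval α (mulX n) = α * bitEval α n := by
  have h285 : bitEval α 285 = 0 := by
    rw [← hα]
    simp [bitEval, Finset.sum_range_succ, Nat.testBit]
    ring
  unfold mulX
  split_ifs
  · exact bitEval_two_mul α hn
  · rw [bitEval_xor, h285, add_zero, bitEval_two_mul α hn]

lemma mulX_lt {n : ℕ} (hn : n < 256) : mulX n < 256 := by
  revert n
  decide +kernel

lemma powX_lt (k : ℕ) : powX k < 256 := by
  induction k with
  | zero => simp [powX]
  | succ k ih => simpa [powX, Function.iterate_succ_apply'] using mulX_lt ih

lemma bitEval_powX (hα : α ^ 8 + α ^ 4 + α ^ 3 + α ^ 2 + 1 = 0) (k : ℕ) :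
    bitEval α (powX k) = α ^ k := by
  induction k with
  | zero => simp [powX]
  | succ k ih =>
    rw [pow_succ', ← ih, ← bitEval_mulX hα (powX_lt k), powX, Function.iterate_succ_apply', powX]

lemma pow_add_pow (hα : α ^ 8 + α ^ 4 + α ^ 3 + α ^ 2 + 1 = 0) {a b c : ℕ}
    (h : powX a ^^^ powX b = powX c) : α ^ a + α ^ b = α ^ c := by
  rw [← bitEval_powX hα, ← bitEval_powX hα, ← bitEval_xor, h, bitEval_powX hα]

lemma pow_eq_one_of_root (hα : α ^ 8 + α ^ 4 + α ^ 3 + α ^ 2 + 1 = 0) : α ^ 255 = 1 := by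
  rw [← bitEval_powX hα, show powX 255 = 1 by decide +kernel, bitEval_one]

end Arithmetic

lemma ne_zero_of_root {F : Type*} [Field F] {α : F}
    (hα : α ^ 8 + α ^ 4 + α ^ 3 + α ^ 2 + 1 = 0) : α ≠ 0 := by
  rintro rfl
  simp at hα

section Field

variable {F : Type*} [Field F] [Algebra (ZMod 2) F] {α : F}

lemma orderOf_root (hα : α ^ 8 + α ^ 4 + α ^ 3 + α ^ 2 + 1 = 0) : orderOf α = 255 := by
  have key {a b : ℕ} (h : powX a ^^^ powX 0 = powX b) : α ^ a ≠ 1 := fun ha => by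
    have := pow_add_pow hα h
    rw [ha, pow_zero, ZModModule.add_self] at this
    exact pow_ne_zero b (ne_zero_of_root hα) this.symm
  refine orderOf_eq_of_pow_and_pow_div_prime (by norm_num) (pow_eq_one_of_root hα) fun p hp hd => ?_
  rw [show 255 = 3 * 5 * 17 by norm_num, hp.dvd_mul, hp.dvd_mul,
    Nat.prime_dvd_prime_iff_eq hp (by norm_num), Nat.prime_dvd_prime_iff_eq hp (by norm_num),
    Nat.prime_dvd_prime_iff_eq hp (by norm_num)] at hd
  obtain (rfl | rfl) | rfl := hd
  · exact key (a := 85) (b := 170) (by decide +kernel)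
  · exact key (a := 51) (b := 238) (by decide +kernel)
  · exact key (a := 15) (b := 33) (by decide +kernel)

open Polynomial in
lemma exists_root_primitivePoly [Finite F] (hF : Nat.card F = 256) :
    ∃ α : F, α ^ 8 + α ^ 4 + α ^ 3 + α ^ 2 + 1 = 0 := by
  have hdeg : primitivePoly.degree = 8 := by
    unfold primitivePoly
    compute_degree!
  have hdvd : primitivePoly ∣ X ^ 256 - X := by
    rw [← AdjoinRoot.mk_eq_zero]
    have h0 : AdjoinRoot.mk primitivePoly (X ^ 8 + X ^ 4 + X ^ 3 + X ^ 2 + 1) = 0 :=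
      AdjoinRoot.mk_self
    simp only [map_add, map_pow, map_one] at h0
    have h1 := pow_eq_one_of_root h0
    rw [map_sub, map_pow, pow_succ, h1, one_mul, sub_self]
  have hsplits := FiniteField.splits_X_pow_nat_card_sub_X 2 (K := F)
  rw [hF] at hsplits
  have hne : (X ^ 256 - X : (ZMod 2)[X]) ≠ 0 := FiniteField.X_pow_card_sub_X_ne_zero _ (by norm_num)
  have hs : (primitivePoly.map (algebraMap (ZMod 2) F)).Splits :=
    hsplits.of_dvd (Polynomial.map_ne_zero hne) (Polynomial.map_dvd _ hdvd)
  obtain ⟨α, hα⟩ := hs.exists_eval_eq_zero (by rw [degree_map, hdeg]; decide)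
  exact ⟨α, by simpa [primitivePoly] using hα⟩

end Field
/-- Exponents of the nonzero elements of the five base planes, as powers of a root of
`primitivePoly`. -/
def planeExponents : Fin 5 → Finset ℕ
  | 0 => {0, 1, 4, 14, 25, 100, 224}
  | 1 => {0, 2, 30, 50, 66, 72, 195}
  | 2 => {0, 26, 81, 89, 160, 198, 203}
  | 3 => {0, 51, 91, 135, 144, 209, 238}
  | 4 => {0, 15, 33, 102, 163, 182, 221}

lemma planeExponents_add : ∀ i, ∀ a ∈ planeExponents i, ∀ b ∈ planeExponents i,
    a = b ∨ ∃ c ∈ planeExponents i, powX a ^^^ powX b = powX c := by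
  decide +kernel

lemma planeExponents_lt : ∀ i, ∀ a ∈ planeExponents i, a < 255 := by
  decide +kernel

lemma planeExponents_sidon : ∀ i j, ∀ a ∈ planeExponents i, ∀ b ∈ planeExponents i,
    ∀ c ∈ planeExponents j, ∀ d ∈ planeExponents j,
    (a + d) % 255 = (c + b) % 255 → a = b ∨ i = j ∧ a = c := by
  decide +kernel

section BasePlanes

variable {F : Type*} [Field F] [Algebra (ZMod 2) F] {α : F}

/-- The `i`-th base plane, attached to a root `α` of `primitivePoly`. -/
def basePlane (hα : α ^ 8 + α ^ 4 + α ^ 3 + α ^ 2 + 1 = 0) (i : Fin 5) : Submodule (ZMod 2) F :=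
  AddSubgroup.toZModSubmodule 2
    { carrier := insert 0 ((α ^ ·) '' (planeExponents i : Set ℕ))
      zero_mem' := Set.mem_insert _ _
      add_mem' := by
        rintro _ _ (rfl | ⟨a, ha, rfl⟩) (rfl | ⟨b, hb, rfl⟩)
        · simp
        · rw [zero_add]
          exact Or.inr ⟨b, hb, rfl⟩
        · rw [add_zero]
          exact Or.inr ⟨a, ha, rfl⟩
        · obtain rfl | ⟨c, hc, h⟩ := planeExponents_add i a ha b hb
          · exact Or.inl (ZModModule.add_self _)
          · exact Or.inr ⟨c, hc, (pow_add_pow hα h).symm⟩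
      neg_mem' := fun {x} hx => by rwa [ZModModule.neg_eq_self] }

variable (hα : α ^ 8 + α ^ 4 + α ^ 3 + α ^ 2 + 1 = 0)

lemma coe_basePlane (i : Fin 5) :
    (basePlane hα i : Set F) = insert 0 ((α ^ ·) '' (planeExponents i : Set ℕ)) := rfl

lemma exists_exponent_of_mem_basePlane {i : Fin 5} {x : F} (hx : x ∈ basePlane hα i)
    (hx0 : x ≠ 0) : ∃ a ∈ planeExponents i, α ^ a = x := by
  obtain h | h := hx
  · exact absurd h hx0
  · exact h

lemma pow_eq_pow_iff_of_root (hα : α ^ 8 + α ^ 4 + α ^ 3 + α ^ 2 + 1 = 0) (a b : ℕ) :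
    α ^ a = α ^ b ↔ a % 255 = b % 255 := by
  have h : IsOfFinOrder α := isOfFinOrder_iff_pow_eq_one.2 ⟨255, by norm_num, pow_eq_one_of_root hα⟩
  rw [h.pow_inj_mod, orderOf_root hα]

lemma finrank_basePlane [Finite F] (i : Fin 5) : finrank (ZMod 2) (basePlane hα i) = 3 := by
  have hinj : Set.InjOn (α ^ ·) (planeExponents i : Set ℕ) := fun a ha b hb h => by
    have := (pow_eq_pow_iff_of_root hα a b).1 h
    rwa [Nat.mod_eq_of_lt (planeExponents_lt i a ha), Nat.mod_eq_of_lt (planeExponents_lt i b hb)]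
      at this
  have hcard : Nat.card (basePlane hα i) = 8 := by
    rw [← SetLike.coe_sort_coe, Nat.card_coe_set_eq, coe_basePlane, Set.ncard_insert_of_notMem,
      hinj.ncard_image, Set.ncard_coe_finset]
    · clear hinj
      revert i
      decide
    · rintro ⟨a, -, ha⟩
      exact pow_ne_zero a (ne_zero_of_root hα) ha
  rw [Module.natCard_eq_pow_finrank (K := ZMod 2), Nat.card_zmod] at hcard
  exact Nat.pow_right_injective le_rfl (hcard.trans (by norm_num : 8 = 2 ^ 3))

lemma basePlane_sidon {i j : Fin 5} {x y z w : F} (hx : x ∈ basePlane hα i)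
    (hy : y ∈ basePlane hα i) (hz : z ∈ basePlane hα j) (hw : w ∈ basePlane hα j)
    (hx0 : x ≠ 0) (hy0 : y ≠ 0) (hz0 : z ≠ 0) (hw0 : w ≠ 0) (hxy : x ≠ y)
    (h : x * w = z * y) : i = j ∧ x = z := by
  obtain ⟨a, ha, rfl⟩ := exists_exponent_of_mem_basePlane hα hx hx0
  obtain ⟨b, hb, rfl⟩ := exists_exponent_of_mem_basePlane hα hy hy0
  obtain ⟨c, hc, rfl⟩ := exists_exponent_of_mem_basePlane hα hz hz0
  obtain ⟨d, hd, rfl⟩ := exists_exponent_of_mem_basePlane hα hw hw0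
  rw [← pow_add, ← pow_add, pow_eq_pow_iff_of_root hα] at h
  obtain rfl | ⟨rfl, rfl⟩ := planeExponents_sidon i j a ha b hb c hc d hd h
  · exact absurd rfl hxy
  · exact ⟨rfl, rfl⟩

end BasePlanes
section CyclicShift

variable {K F : Type*} [Field K] [Field F] [Algebra K F]

lemma mem_cyclicShift {α : F} (hα : α ≠ 0) {V : Submodule K F} {x : F} :
    x ∈ cyclicShift K F α V ↔ α⁻¹ * x ∈ V := by
  simp only [cyclicShift, Submodule.mem_map, LinearMap.mulLeft_apply]
  refine ⟨?_, fun h => ⟨_, h, mul_inv_cancel_left₀ hα x⟩⟩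
  rintro ⟨y, hy, rfl⟩
  rwa [inv_mul_cancel_left₀ hα]

lemma mul_mem_cyclicShift {α x : F} {V : Submodule K F} (hx : x ∈ V) :
    α * x ∈ cyclicShift K F α V :=
  Submodule.mem_map_of_mem hx

lemma cyclicShift_cyclicShift (α β : F) (V : Submodule K F) :
    cyclicShift K F α (cyclicShift K F β V) = cyclicShift K F (α * β) V := by
  rw [cyclicShift, cyclicShift, cyclicShift, ← Submodule.map_comp, LinearMap.mulLeft_mul]

lemma cyclicShift_one (V : Submodule K F) : cyclicShift K F 1 V = V := by
  rw [cyclicShift, LinearMap.mulLeft_one, Submodule.map_id]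

lemma finrank_cyclicShift {α : F} (hα : α ≠ 0) (V : Submodule K F) :
    finrank K (cyclicShift K F α V) = finrank K V :=
  (Submodule.equivMapOfInjective _ (mul_right_injective₀ hα) V).finrank_eq.symm

end CyclicShift

section Construction

variable {F : Type*} [Field F] [Algebra (ZMod 2) F] {α : F}
  (hα : α ^ 8 + α ^ 4 + α ^ 3 + α ^ 2 + 1 = 0)

/-- The shift of the `p.1`-th base plane by `p.2`. -/
def shiftedPlane (p : Fin 5 × Fˣ) : Submodule (ZMod 2) F :=
  cyclicShift (ZMod 2) F p.2 (basePlane hα p.1)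

lemma finrank_shiftedPlane [Finite F] (p : Fin 5 × Fˣ) :
    finrank (ZMod 2) (shiftedPlane hα p) = 3 := by
  rw [shiftedPlane, finrank_cyclicShift p.2.ne_zero, finrank_basePlane]

/-- A space of dimension at least two over `𝔽₂` contains two distinct nonzero vectors. -/
lemma exists_ne_of_one_lt_finrank [Finite F] {V : Submodule (ZMod 2) F}
    (hV : 1 < finrank (ZMod 2) V) : ∃ x ∈ V, ∃ y ∈ V, x ≠ 0 ∧ y ≠ 0 ∧ x ≠ y := by
  have : Nontrivial V := Module.nontrivial_of_finrank_pos (R := ZMod 2) (by omega)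
  obtain ⟨x, hx⟩ := exists_ne (0 : V)
  obtain ⟨y, hy⟩ := exists_linearIndependent_pair_of_one_lt_finrank hV hx
  have hy0 := hy.ne_zero 1
  have hxy := hy.injective.ne (show (0 : Fin 2) ≠ 1 by decide)
  exact ⟨x, x.2, y, y.2, Subtype.coe_ne_coe.2 hx, Subtype.coe_ne_coe.2 hy0, Subtype.coe_ne_coe.2 hxy⟩

lemma eq_of_one_lt_finrank_inf [Finite F] {p r : Fin 5 × Fˣ}
    (h : 1 < finrank (ZMod 2) ↥(shiftedPlane hα p ⊓ shiftedPlane hα r)) : p = r := by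
  obtain ⟨i, β⟩ := p
  obtain ⟨j, γ⟩ := r
  obtain ⟨u, ⟨⟨x, hx, hxu⟩, ⟨z, hz, hzu⟩⟩, v, ⟨⟨y, hy, hyv⟩, ⟨w, hw, hwv⟩⟩, hu, hv, huv⟩ :=
    exists_ne_of_one_lt_finrank h
  simp only [LinearMap.mulLeft_apply] at hxu hzu hyv hwv
  have hne {a : Fˣ} {b c : F} (h : a * b = c) (hc : c ≠ 0) : b ≠ 0 := by
    rintro rfl
    exact hc (by rw [← h, mul_zero])
  have hprod : x * w = z * y := by
    refine mul_left_cancel₀ (mul_ne_zero β.ne_zero γ.ne_zero) ?_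
    linear_combination (γ * w) * hxu + u * hwv - (γ * z) * hyv - v * hzu
  obtain ⟨rfl, rfl⟩ := basePlane_sidon hα hx hy hz hw (hne hxu hu) (hne hyv hv) (hne hzu hu)
    (hne hwv hv) (by rintro rfl; exact huv (hxu.symm.trans hyv)) hprod
  have := mul_right_cancel₀ (hne hxu hu) (hxu.trans hzu.symm)
  rw [Units.ext this]

lemma shiftedPlane_injective [Finite F] : Function.Injective (shiftedPlane hα) := fun p r h =>
  eq_of_one_lt_finrank_inf hα (by rw [h, inf_idem, finrank_shiftedPlane]; norm_num)

lemma isCyclicCode_range_shiftedPlane [Finite F] :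
    IsCyclicCode (ZMod 2) F 3 4 (Set.range (shiftedPlane hα)) := by
  refine ⟨?_, ?_, ?_⟩
  · rintro _ ⟨p, rfl⟩
    exact finrank_shiftedPlane hα p
  · rintro β hβ _ ⟨⟨i, γ⟩, rfl⟩
    exact ⟨(i, Units.mk0 β hβ * γ), (cyclicShift_cyclicShift _ _ _).symm⟩
  · rintro _ ⟨p, rfl⟩ _ ⟨r, rfl⟩ hne
    have := mt (eq_of_one_lt_finrank_inf hα) (fun h : p = r => hne (congrArg _ h))
    rw [subspaceDist, finrank_shiftedPlane, finrank_shiftedPlane]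
    omega

lemma ncard_range_shiftedPlane [Finite F] (hF : Nat.card F = 256) :
    (Set.range (shiftedPlane hα)).ncard = 1275 := by
  rw [← Nat.card_coe_set_eq, Nat.card_range_of_injective (shiftedPlane_injective hα),
    Nat.card_prod, Nat.card_fin, Nat.card_units, hF]

lemma orbitOf_shiftedPlane (i : Fin 5) (γ : Fˣ) :
    orbitOf (ZMod 2) F (shiftedPlane hα (i, γ)) = Set.range fun β => shiftedPlane hα (i, β) := by
  ext W
  constructor
  · rintro ⟨β, hβ, rfl⟩
    exact ⟨Units.mk0 β hβ * γ, (cyclicShift_cyclicShift _ _ _).symm⟩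
  · rintro ⟨β, rfl⟩
    refine ⟨↑(β * γ⁻¹), (β * γ⁻¹).ne_zero, ?_⟩
    simp only [shiftedPlane, cyclicShift_cyclicShift, ← Units.val_mul, inv_mul_cancel_right]

lemma orbitsOf_range_shiftedPlane :
    orbitsOf (ZMod 2) F (Set.range (shiftedPlane hα)) =
      Set.range fun i => Set.range fun β => shiftedPlane hα (i, β) := by
  ext O
  constructor
  · rintro ⟨_, ⟨⟨i, γ⟩, rfl⟩, rfl⟩
    exact ⟨i, (orbitOf_shiftedPlane hα i γ).symm⟩
  · rintro ⟨i, rfl⟩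
    exact ⟨_, ⟨(i, 1), rfl⟩, (orbitOf_shiftedPlane hα i 1).symm⟩

lemma ncard_orbitsOf_range_shiftedPlane [Finite F] :
    (orbitsOf (ZMod 2) F (Set.range (shiftedPlane hα))).ncard = 5 := by
  have hinj : Function.Injective fun i => Set.range fun β => shiftedPlane hα (i, β) := by
    intro i j h
    have hmem : shiftedPlane hα (i, 1) ∈ Set.range fun β => shiftedPlane hα (j, β) := by
      beta_reduce at h
      rw [← h]
      exact ⟨1, rfl⟩
    obtain ⟨β, hβ⟩ := hmem
    exact (congrArg Prod.fst (shiftedPlane_injective hα hβ)).symm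
  rw [orbitsOf_range_shiftedPlane, ← Nat.card_coe_set_eq, Nat.card_range_of_injective hinj,
    Nat.card_fin]

lemma ncard_of_mem_orbitsOf_range_shiftedPlane [Finite F] (hF : Nat.card F = 256)
    {O : Set (Submodule (ZMod 2) F)}
    (hO : O ∈ orbitsOf (ZMod 2) F (Set.range (shiftedPlane hα))) : O.ncard = 255 := by
  rw [orbitsOf_range_shiftedPlane] at hO
  obtain ⟨i, rfl⟩ := hO
  have hinj : Function.Injective fun β => shiftedPlane hα (i, β) :=
    (shiftedPlane_injective hα).comp (Prod.mk_right_injective i)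
  rw [← Nat.card_coe_set_eq, Nat.card_range_of_injective hinj, Nat.card_units, hF]

end Construction
section UpperBound

variable {F : Type*} [Field F] [Algebra (ZMod 2) F]

open Classical in
/-- A linear functional over `𝔽₂` that is nonzero on `V` takes the value `1` on half of `V`. -/
lemma two_mul_card_filter_eq_one [Fintype F] (f : F →ₗ[ZMod 2] ZMod 2) {V : Submodule (ZMod 2) F}
    {v : F} (hv : v ∈ V) (hfv : f v = 1) :
    2 * (Finset.univ.filter fun x => x ∈ V ∧ f x = 1).card =
      (Finset.univ.filter fun x => x ∈ V).card := by
  have hvv : v + v = 0 := ZModModule.add_self v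
  have hzmod : ∀ c : ZMod 2, c = 1 ↔ ¬ c + 1 = 1 := by decide
  have hswap : (Finset.univ.filter fun x => x ∈ V ∧ f x = 1).card =
      (Finset.univ.filter fun x => x ∈ V ∧ ¬ f x = 1).card := by
    refine Finset.card_bij' (fun x _ => x + v) (fun x _ => x + v) ?_ ?_ ?_ ?_ <;>
      simp only [Finset.mem_filter_univ, add_assoc, hvv, add_zero, implies_true, map_add, hfv]
    · exact fun x hx => ⟨V.add_mem hx.1 hv, (hzmod _).1 hx.2⟩
    · exact fun x hx => ⟨V.add_mem hx.1 hv, not_not.1 (mt (hzmod _).2 hx.2)⟩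
  have := Finset.card_filter_add_card_filter_not (s := Finset.univ.filter fun x => x ∈ V)
    (fun x => f x = 1)
  rw [Finset.filter_filter, Finset.filter_filter] at this
  omega

open Classical in
lemma card_filter_mem [Fintype F] (V : Submodule (ZMod 2) F) :
    (Finset.univ.filter fun x => x ∈ V).card = 2 ^ finrank (ZMod 2) V := by
  rw [← Fintype.card_subtype, ← Nat.card_eq_fintype_card,
    Module.natCard_eq_pow_finrank (K := ZMod 2), Nat.card_zmod]

open Classical in
lemma card_filter_mem_ne_zero [Fintype F] (V : Submodule (ZMod 2) F) :
    (Finset.univ.filter fun x => x ≠ 0 ∧ x ∈ V).card = 2 ^ finrank (ZMod 2) V - 1 := by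
  rw [← card_filter_mem, ← Finset.card_erase_of_mem (a := (0 : F)) (by simp)]
  congr 1
  ext x
  simp

open Classical in
lemma card_filter_mem_ne_zero_ne_one [Fintype F] {V : Submodule (ZMod 2) F} (h1 : (1 : F) ∈ V) :
    (Finset.univ.filter fun x => (x ≠ 0 ∧ x ≠ 1) ∧ x ∈ V).card = 2 ^ finrank (ZMod 2) V - 2 := by
  rw [← Nat.sub_sub _ 1 1, ← card_filter_mem_ne_zero,
    ← Finset.card_erase_of_mem (a := (1 : F)) (by simp [h1])]
  congr 1
  ext x
  simp only [Finset.mem_erase, Finset.mem_filter_univ]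
  tauto

lemma exists_linearMap_eq_one {a : F} (ha0 : a ≠ 0) (ha1 : a ≠ 1) :
    ∃ f : F →ₗ[ZMod 2] ZMod 2, f 1 = 0 ∧ f a = 1 := by
  have ha : a ∉ Submodule.span (ZMod 2) {(1 : F)} := by
    rw [Submodule.mem_span_singleton]
    rintro ⟨c, rfl⟩
    fin_cases c
    · exact ha0 (zero_smul _ _)
    · exact ha1 (one_smul _ _)
  obtain ⟨f, hfa, hf⟩ := Submodule.exists_le_ker_of_notMem ha
  refine ⟨f, hf (Submodule.mem_span_singleton_self 1), ?_⟩
  have hzmod : ∀ c : ZMod 2, c ≠ 0 → c = 1 := by decide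
  exact hzmod _ hfa

open Classical in
/-- At most 41 planes containing `1` can meet pairwise in the line `𝔽₂`. -/
lemma card_planes_le [Fintype F] (hF : Fintype.card F = 256)
    {S : Finset (Submodule (ZMod 2) F)} (hrank : ∀ U ∈ S, finrank (ZMod 2) U = 3)
    (hone : ∀ U ∈ S, (1 : F) ∈ U)
    (hinter : ∀ U ∈ S, ∀ W ∈ S, U ≠ W → ∀ x, x ∈ U → x ∈ W → x = 0 ∨ x = 1) : S.card ≤ 41 := by
  have hdisj (P : F → Prop) [DecidablePred P] (hP : ∀ x, P x → x ≠ 0 ∧ x ≠ 1) :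
      (S : Set (Submodule (ZMod 2) F)).PairwiseDisjoint
        fun U => Finset.univ.filter fun x : F => P x ∧ x ∈ U := by
    intro U hU W hW hne
    refine Finset.disjoint_left.2 fun x hxU hxW => ?_
    simp only [Finset.mem_filter_univ] at hxU hxW
    exact (hinter U hU W hW hne x hxU.2 hxW.2).elim (hP x hxU.1).1 (hP x hxU.1).2
  -- `B` is the set covered by the planes, `R` the uncovered rest.
  set B := S.biUnion fun U => Finset.univ.filter fun x : F => (x ≠ 0 ∧ x ≠ 1) ∧ x ∈ U with hB
  set R := Finset.univ.filter fun x : F => (x ≠ 0 ∧ x ≠ 1) ∧ ∀ U ∈ S, x ∉ U with hR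
  have hBcard : B.card = 6 * S.card := by
    rw [hB, Finset.card_biUnion (hdisj _ fun _ h => h), Finset.sum_congr rfl fun U hU => by
      rw [card_filter_mem_ne_zero_ne_one (hone U hU), hrank U hU]]
    simp [mul_comm]
  have hBR : B.card + R.card = 254 := by
    have htop := card_filter_mem_ne_zero_ne_one (Submodule.mem_top (R := ZMod 2) (x := (1 : F)))
    rw [← card_filter_mem] at htop
    simp only [Submodule.mem_top, and_true, Finset.filter_true, Finset.card_univ, hF] at htop
    rw [← Finset.card_union_of_disjoint, show 254 = 256 - 2 by norm_num, ← htop]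
    · congr 1
      ext x
      simp only [hB, hR, Finset.mem_union, Finset.mem_biUnion, Finset.mem_filter_univ]
      by_cases h : ∃ U ∈ S, x ∈ U <;> grind
    · refine Finset.disjoint_left.2 fun x hxB hxR => ?_
      simp only [hB, hR, Finset.mem_biUnion, Finset.mem_filter_univ] at hxB hxR
      grind
  by_contra! hS
  have hRcard : R.card = 2 := by omega
  obtain ⟨a, haR⟩ : R.Nonempty := Finset.card_pos.1 (by omega)
  have ha := haR
  simp only [hR, Finset.mem_filter_univ] at ha
  obtain ⟨f, hf1, hfa⟩ := exists_linearMap_eq_one ha.1.1 ha.1.2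
  have hne (x : F) (hx : f x = 1) : x ≠ 0 ∧ x ≠ 1 := by
    constructor <;> rintro rfl <;> simp_all
  have hhalf : (Finset.univ.filter fun x => f x = 1).card = 128 := by
    have := two_mul_card_filter_eq_one f (Submodule.mem_top (R := ZMod 2) (x := a)) hfa
    simp only [Submodule.mem_top, true_and, Finset.filter_true, Finset.card_univ, hF] at this
    omega
  have hsplit : (Finset.univ.filter fun x => f x = 1).card =
      ∑ U ∈ S, (Finset.univ.filter fun x => f x = 1 ∧ x ∈ U).card +
        (R.filter fun x => f x = 1).card := by
    rw [← Finset.card_biUnion (hdisj _ hne), ← Finset.card_union_of_disjoint]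
    · congr 1
      ext x
      have := hne x
      simp only [hR, Finset.mem_union, Finset.mem_biUnion, Finset.mem_filter]
      by_cases h : ∃ U ∈ S, x ∈ U <;> grind
    · refine Finset.disjoint_left.2 fun x hxB hxR => ?_
      simp only [hR, Finset.mem_biUnion, Finset.mem_filter] at hxB hxR
      grind
  have hfour : 4 ∣ ∑ U ∈ S, (Finset.univ.filter fun x => f x = 1 ∧ x ∈ U).card := by
    refine Finset.dvd_sum fun U hU => ?_
    by_cases h : ∃ v ∈ U, f v = 1
    · obtain ⟨v, hv, hfv⟩ := h
      have := two_mul_card_filter_eq_one f hv hfv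
      rw [card_filter_mem, hrank U hU] at this
      simp only [and_comm (a := f _ = 1)]
      omega
    · rw [Finset.filter_eq_empty_iff.2 fun x _ hx => h ⟨x, hx.2, hx.1⟩]
      simp
  have hpos : 0 < (R.filter fun x => f x = 1).card :=
    Finset.card_pos.2 ⟨a, Finset.mem_filter.2 ⟨haR, hfa⟩⟩
  have hle := Finset.card_filter_le R fun x => f x = 1
  omega

lemma eq_zero_or_one_of_mem_inf [Finite F] {U W : Submodule (ZMod 2) F}
    (h : finrank (ZMod 2) ↥(U ⊓ W) ≤ 1) (hU : (1 : F) ∈ U) (hW : (1 : F) ∈ W) {x : F}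
    (hxU : x ∈ U) (hxW : x ∈ W) : x = 0 ∨ x = 1 := by
  obtain ⟨v, hv⟩ := finrank_le_one_iff.1 h
  obtain ⟨c, hc⟩ := hv ⟨1, hU, hW⟩
  obtain ⟨d, hd⟩ := hv ⟨x, hxU, hxW⟩
  have hzmod : ∀ c : ZMod 2, c = 0 ∨ c = 1 := by decide
  obtain rfl | rfl := hzmod c
  · simp [Subtype.ext_iff] at hc
  · obtain rfl | rfl := hzmod d
    · left
      simpa [Subtype.ext_iff] using hd.symm
    · right
      exact congrArg Subtype.val (hd.symm.trans hc)

open Classical in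
/-- Double counting of the incidences between the members of a cyclic code and the nonzero field
elements. -/
lemma card_mul_eq_of_isCyclicCode [Fintype F] {k d : ℕ} {C : Finset (Submodule (ZMod 2) F)}
    (hC : IsCyclicCode (ZMod 2) F k d C) :
    C.card * (2 ^ k - 1) = (Fintype.card F - 1) * (C.filter fun U => (1 : F) ∈ U).card := by
  have hcount := Finset.sum_card_bipartiteAbove_eq_sum_card_bipartiteBelow
    (fun (U : Submodule (ZMod 2) F) (x : F) => x ∈ U) (s := C) (t := Finset.univ.erase 0)
  rw [Finset.sum_const_nat (m := 2 ^ k - 1), Finset.sum_const_nat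
    (m := (C.filter fun U => (1 : F) ∈ U).card), Finset.card_erase_of_mem (Finset.mem_univ _),
    Finset.card_univ] at hcount
  · exact hcount
  · intro x hx
    have hx0 := Finset.ne_of_mem_erase hx
    refine Finset.card_bij' (fun U _ => cyclicShift (ZMod 2) F x⁻¹ U)
      (fun U _ => cyclicShift (ZMod 2) F x U) ?_ ?_ ?_ ?_ <;>
      simp only [Finset.bipartiteBelow, Finset.mem_filter, cyclicShift_cyclicShift,
        inv_mul_cancel₀ hx0, mul_inv_cancel₀ hx0, cyclicShift_one, implies_true,
        mem_cyclicShift hx0, mem_cyclicShift (inv_ne_zero hx0), inv_inv, mul_one]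
    · exact fun U hU => ⟨hC.2.1 _ (inv_ne_zero hx0) U hU.1, hU.2⟩
    · exact fun U hU => ⟨hC.2.1 _ hx0 U hU.1, hU.2⟩
  · intro U hU
    rw [← hC.1 U hU, ← card_filter_mem_ne_zero]
    congr 1
    ext x
    simp [Finset.bipartiteAbove]

lemma ncard_le_of_isCyclicCode [Finite F] (hF : Nat.card F = 256)
    {C : Set (Submodule (ZMod 2) F)} (hC : IsCyclicCode (ZMod 2) F 3 4 C) : C.ncard ≤ 1275 := by
  classical
  have := Fintype.ofFinite F
  rw [Nat.card_eq_fintype_card] at hF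
  lift C to Finset (Submodule (ZMod 2) F) using C.toFinite
  have hcount := card_mul_eq_of_isCyclicCode hC
  have hle : (C.filter fun U => (1 : F) ∈ U).card ≤ 41 := by
    refine card_planes_le hF (fun U hU => hC.1 U (Finset.mem_filter.1 hU).1)
      (fun U hU => (Finset.mem_filter.1 hU).2) fun U hU W hW hne x hxU hxW => ?_
    rw [Finset.mem_filter] at hU hW
    have hdist := hC.2.2 U hU.1 W hW.1 hne
    rw [subspaceDist, hC.1 U hU.1, hC.1 W hW.1] at hdist
    exact eq_zero_or_one_of_mem_inf (by omega) hU.2 hW.2 hxU hxW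
  rw [hF] at hcount
  rw [Set.ncard_coe_finset]
  omega

end UpperBound

/-- 𝒞_2(8,4,3) = 1275, attained by a code consisting of 5 orbits of
cardinality 255. -/
theorem C2_8_4_3_eq_1275 :
    IsGreatest {m : ℕ | ∃ C : Set (Submodule (ZMod 2) (GaloisField 2 8)),
      IsCyclicCode (ZMod 2) (GaloisField 2 8) 3 4 C ∧ C.ncard = m} 1275 ∧
    ∃ C : Set (Submodule (ZMod 2) (GaloisField 2 8)),
      IsCyclicCode (ZMod 2) (GaloisField 2 8) 3 4 C ∧ C.ncard = 1275 ∧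
      (orbitsOf (ZMod 2) (GaloisField 2 8) C).ncard = 5 ∧
      ∀ O ∈ orbitsOf (ZMod 2) (GaloisField 2 8) C, O.ncard = 255 := by
  have hF : Nat.card (GaloisField 2 8) = 256 := GaloisField.card 2 8 (by norm_num)
  obtain ⟨α, hα⟩ := exists_root_primitivePoly hF
  have hcode := isCyclicCode_range_shiftedPlane hα
  have hcard := ncard_range_shiftedPlane hα hF
  refine ⟨⟨⟨_, hcode, hcard⟩, ?_⟩, _, hcode, hcard, ncard_orbitsOf_range_shiftedPlane hα,
    fun O hO => ncard_of_mem_orbitsOf_range_shiftedPlane hα hF hO⟩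
  rintro _ ⟨C, hC, rfl⟩
  exact ncard_le_of_isCyclicCode hF hC
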